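/- arXiv:1610.01800 — 4 statements merged into one kernel-verified Lean document; each statement's English description precedes it below -/
import Mathlib

section
/- Let L be a complete lattice of finite height equipped with a commutator multiplication [·,·], with associated residuation (·:·). Then: (1) L is of solvable type if and only if there is no β ∈ L with β ≠ 0 and [β,β] = β; (2) L is of nilpotent type if and only if there is no β ∈ L with β ≠ 0 and [1,β] = β; (3) if moreover L is modular, then L is of nilpotent type if and only if for all α, β ∈ L with α ≺ β one has (α : β) = 1. -/
/-- A commutator multiplication on a complete lattice `L`: a binary operation that is
commutative, below the meet, and distributes over arbitrary joins. -/
def IsCommutatorMult {L : Type*} [CompleteLattice L] (c : L → L → L) : Prop :=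
  (∀ x y : L, c x y = c y x) ∧
  (∀ x y : L, c x y ≤ x ⊓ y) ∧
  (∀ (S : Set L) (y : L), c (sSup S) y = ⨆ x ∈ S, c x y)

/-- The residuation `(x : y)` associated with a commutator multiplication. -/
def resid {L : Type*} [CompleteLattice L] (c : L → L → L) (x y : L) : L :=
  sSup {z : L | c z y ≤ x}

/-- `[α, β] ↗ [γ, δ]`, i.e. `δ = β ⊔ γ` and `α = β ⊓ γ`. -/
def TransUp {L : Type*} [Lattice L] (p q : L × L) : Prop :=
  q.2 = p.2 ⊔ q.1 ∧ p.1 = p.2 ⊓ q.1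

/-- Projectivity of intervals: the equivalence relation generated by `↗`. -/
def ProjIntv {L : Type*} [Lattice L] : L × L → L × L → Prop :=
  Relation.EqvGen TransUp

/-- `η⁺ = ⋀ { β | η < β }`. -/
def mplus {L : Type*} [CompleteLattice L] (η : L) : L := sInf {β : L | η < β}

/-- `ρ⁻ = ⋁ { α | α < ρ }`. -/
def jminus {L : Type*} [CompleteLattice L] (ρ : L) : L := sSup {α : L | α < ρ}

/-- `η` is meet irreducible if `η < η⁺`. -/
def MeetIrred {L : Type*} [CompleteLattice L] (η : L) : Prop := η < mplus η

/-- `ρ` is join irreducible if `ρ⁻ < ρ`. -/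
def JoinIrred {L : Type*} [CompleteLattice L] (ρ : L) : Prop := jminus ρ < ρ

/-- `Γ(α,β) = ⋁ { η ∈ M(L) | [η,η⁺] ⟷ [α,β] }`. -/
def GammaEl {L : Type*} [CompleteLattice L] (α β : L) : L :=
  sSup {η : L | MeetIrred η ∧ ProjIntv (η, mplus η) (α, β)}

/-- `Δ(α,β) = ⋁ { ρ ∈ J(L) | [ρ⁻,ρ] ⟷ [α,β] }`. -/
def DeltaEl {L : Type*} [CompleteLattice L] (α β : L) : L :=
  sSup {ρ : L | JoinIrred ρ ∧ ProjIntv (jminus ρ, ρ) (α, β)}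

/-- A lonesome meet irreducible element. -/
def LonesomeMeet {L : Type*} [CompleteLattice L] (η : L) : Prop :=
  MeetIrred η ∧ ∀ φ : L, MeetIrred φ → ProjIntv (φ, mplus φ) (η, mplus η) → φ = η

/-- A lonesome join irreducible element. -/
def LonesomeJoin {L : Type*} [CompleteLattice L] (ρ : L) : Prop :=
  JoinIrred ρ ∧ ∀ σ : L, JoinIrred σ → ProjIntv (jminus σ, σ) (jminus ρ, ρ) → σ = ρ

/-- The interval `[a,b]` projects into the interval `[c,d]`. -/
def ProjInto {L : Type*} [CompleteLattice L] (a b c d : L) : Prop :=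
  ∃ a₁ b₁ : L, c ≤ a₁ ∧ a₁ ≤ b₁ ∧ b₁ ≤ d ∧ ProjIntv (a, b) (a₁, b₁)

/-- A complete congruence on a complete lattice. -/
def IsCompleteCongruence {L : Type*} [CompleteLattice L] (Θ : L → L → Prop) : Prop :=
  Equivalence Θ ∧
  ∀ S : Set (L × L), (∀ p ∈ S, Θ p.1 p.2) →
    Θ (⨆ p ∈ S, p.1) (⨆ p ∈ S, p.2) ∧ Θ (⨅ p ∈ S, p.1) (⨅ p ∈ S, p.2)

/-- The largest commutator operation `⌊x,y⌋` on a complete lattice. -/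
def lcomm {L : Type*} [CompleteLattice L] (x y : L) : L :=
  sSup {z : L | ∃ c : L → L → L, IsCommutatorMult c ∧ z = c x y}

/-- The derived series `γ₁ = 1, γ_{n+1} = [γ_n, γ_n]` (indexed from 0). -/
def derivedSeq {L : Type*} [CompleteLattice L] (c : L → L → L) : ℕ → L
  | 0 => ⊤
  | n + 1 => c (derivedSeq c n) (derivedSeq c n)

/-- The lower central series `λ₁ = 1, λ_{n+1} = [1, λ_n]` (indexed from 0). -/
def lowerCentralSeq {L : Type*} [CompleteLattice L] (c : L → L → L) : ℕ → L
  | 0 => ⊤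
  | n + 1 => c ⊤ (lowerCentralSeq c n)

/-- A commutator lattice is of solvable type if its derived series reaches `0`. -/
def SolvableType {L : Type*} [CompleteLattice L] (c : L → L → L) : Prop :=
  ∃ n, derivedSeq c n = ⊥

/-- A commutator lattice is of nilpotent type if its lower central series reaches `0`. -/
def NilpotentType {L : Type*} [CompleteLattice L] (c : L → L → L) : Prop :=
  ∃ n, lowerCentralSeq c n = ⊥

/-- `L` forces abelian type if `⌊1,1⌋ = 0`. -/
def ForcesAbelianType (L : Type*) [CompleteLattice L] : Prop := lcomm (⊤ : L) ⊤ = ⊥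

/-- `L` forces nilpotent type. -/
def ForcesNilpotentType (L : Type*) [CompleteLattice L] : Prop :=
  NilpotentType (lcomm : L → L → L)

/-- `L` forces solvable type. -/
def ForcesSolvableType (L : Type*) [CompleteLattice L] : Prop :=
  SolvableType (lcomm : L → L → L)

/-- `e` realizes `L` as a complete sublattice of `K`: `e` is injective and preserves
arbitrary nonempty joins and meets. -/
def IsCompleteSublatticeEmb {L K : Type*} [CompleteLattice L] [CompleteLattice K]
    (e : L → K) : Prop :=
  Function.Injective e ∧
  (∀ S : Set L, S.Nonempty → e (sSup S) = sSup (e '' S)) ∧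
  (∀ S : Set L, S.Nonempty → e (sInf S) = sInf (e '' S))

/-- A complete lattice homomorphism: preserves arbitrary joins and arbitrary meets. -/
def IsCompleteLatticeHom {L K : Type*} [CompleteLattice L] [CompleteLattice K]
    (h : L → K) : Prop :=
  (∀ S : Set L, h (sSup S) = sSup (h '' S)) ∧
  (∀ S : Set L, h (sInf S) = sInf (h '' S))

/-- A lattice has finite height if there is a finite bound on the lengths of its chains. -/
def FiniteHeight (L : Type*) [Preorder L] : Prop :=
  ∃ n : ℕ, ∀ l : List L, l.Chain' (· < ·) → l.length ≤ n

/-- A lattice congruence: an equivalence relation compatible with `⊔` and `⊓`. -/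
def IsLatticeCongruence {L : Type*} [Lattice L] (Θ : L → L → Prop) : Prop :=
  Equivalence Θ ∧
  ∀ a b x y : L, Θ a b → Θ x y → Θ (a ⊔ x) (b ⊔ y) ∧ Θ (a ⊓ x) (b ⊓ y)

/-- A lattice is simple if its only lattice congruences are equality and the all relation. -/
def SimpleLattice (L : Type*) [Lattice L] : Prop :=
  ∀ Θ : L → L → Prop, IsLatticeCongruence Θ →
    (∀ a b : L, Θ a b ↔ a = b) ∨ (∀ a b : L, Θ a b)

theorem FiniteHeight.wellFoundedLT {L : Type*} [Preorder L] (h : FiniteHeight L) :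
    WellFoundedLT L := by
  obtain ⟨n, hn⟩ := h
  refine ⟨RelEmbedding.wellFounded_iff_isEmpty.2 ⟨fun f => ?_⟩⟩
  have hp : ((List.range (n + 1)).reverse.map f).Pairwise (· < ·) := by
    rw [List.pairwise_map, List.pairwise_reverse]
    exact List.pairwise_lt_range.imp fun hab => f.map_rel_iff.2 hab
  have hl := hn _ hp.isChain
  simp at hl

theorem FiniteHeight.wellFoundedGT {L : Type*} [Preorder L] (h : FiniteHeight L) :
    WellFoundedGT L := by
  obtain ⟨n, hn⟩ := h
  refine ⟨RelEmbedding.wellFounded_iff_isEmpty.2 ⟨fun f => ?_⟩⟩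
  have hp : ((List.range (n + 1)).map f).Pairwise (· < ·) := by
    rw [List.pairwise_map]
    exact List.pairwise_lt_range.imp fun hab => f.map_rel_iff.2 hab
  have hl := hn _ hp.isChain
  simp at hl

namespace IsCommutatorMult

variable {L : Type*} [CompleteLattice L] {c : L → L → L}

theorem sup_left (hc : IsCommutatorMult c) (x y z : L) : c (x ⊔ y) z = c x z ⊔ c y z := by
  rw [← sSup_pair, hc.2.2, iSup_pair]

theorem sup_right (hc : IsCommutatorMult c) (x y z : L) : c x (y ⊔ z) = c x y ⊔ c x z := by
  rw [hc.1, hc.sup_left, hc.1 y, hc.1 z]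

theorem mono (hc : IsCommutatorMult c) {x x' y y' : L} (hx : x ≤ x') (hy : y ≤ y') :
    c x y ≤ c x' y' := by
  calc
    c x y ≤ c x y ⊔ c x' y := le_sup_left
    _ = c x' y := by rw [← hc.sup_left, sup_eq_right.2 hx]
    _ ≤ c x' y ⊔ c x' y' := le_sup_left
    _ = c x' y' := by rw [← hc.sup_right, sup_eq_right.2 hy]

theorem le_right (hc : IsCommutatorMult c) (x y : L) : c x y ≤ y :=
  (hc.2.1 x y).trans inf_le_right

theorem resid_eq_top_iff (hc : IsCommutatorMult c) {x y : L} :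
    resid c x y = ⊤ ↔ c ⊤ y ≤ x := by
  refine ⟨fun h => ?_, fun h => top_le_iff.1 (le_sSup h)⟩
  rw [← h, resid, hc.2.2]
  exact iSup₂_le fun _ hz => hz

end IsCommutatorMult

/-- In a well-founded lattice, the orbit of `⊤` under a monotone deflationary map reaches `⊥`
exactly when the map has no fixed point besides `⊥`. -/
theorem exists_seq_eq_bot_iff {L : Type*} [CompleteLattice L] [WellFoundedLT L]
    {f : L → L} (hf : Monotone f) (hle : ∀ x, f x ≤ x) {s : ℕ → L} (h0 : s 0 = ⊤)
    (hs : ∀ n, s (n + 1) = f (s n)) :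
    (∃ n, s n = ⊥) ↔ ¬ ∃ β : L, β ≠ ⊥ ∧ f β = β := by
  constructor
  · rintro ⟨n, hn⟩ ⟨β, hβ, hfix⟩
    have hle' : ∀ k, β ≤ s k := by
      intro k
      induction k with
      | zero => exact h0 ▸ le_top
      | succ k ih => rw [hs, ← hfix]; exact hf ih
    exact hβ (le_bot_iff.1 (hn ▸ hle' n))
  · intro h
    obtain ⟨_, ⟨n, rfl⟩, hmin⟩ :=
      (wellFounded_lt (α := L)).has_min (Set.range s) (Set.range_nonempty s)
    refine ⟨n, by_contra fun hn => h ⟨s n, hn, ?_⟩⟩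
    exact (hle _).eq_of_not_lt (hs n ▸ hmin _ ⟨n + 1, rfl⟩)

theorem IsCommutatorMult.le_sup_lowerCentralSeq {L : Type*} [CompleteLattice L]
    {c : L → L → L} (hc : IsCommutatorMult c) {α β : L} (h : β ≤ α ⊔ c ⊤ β) (n : ℕ) :
    β ≤ α ⊔ lowerCentralSeq c n := by
  induction n with
  | zero => exact le_top.trans le_sup_right
  | succ n ih =>
    refine h.trans (sup_le le_sup_left ((hc.mono le_rfl ih).trans ?_))
    rw [hc.sup_right]
    exact sup_le_sup_right (hc.le_right _ _) _

/-- characterizations of solvable and nilpotent type in a commutator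
lattice of finite height. -/
theorem statement3 {L : Type*} [CompleteLattice L] (hfin : FiniteHeight L)
    (c : L → L → L) (hc : IsCommutatorMult c) :
    (SolvableType c ↔ ¬ ∃ β : L, β ≠ ⊥ ∧ c β β = β) ∧
    (NilpotentType c ↔ ¬ ∃ β : L, β ≠ ⊥ ∧ c ⊤ β = β) ∧
    (IsModularLattice L →
      (NilpotentType c ↔ ∀ α β : L, α ⋖ β → resid c α β = ⊤)) := by
  have := hfin.wellFoundedLT
  have := hfin.wellFoundedGT
  have hnil : NilpotentType c ↔ ¬ ∃ β : L, β ≠ ⊥ ∧ c ⊤ β = β :=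
    exists_seq_eq_bot_iff (fun _ _ h => hc.mono le_rfl h) (hc.le_right _) rfl fun _ => rfl
  refine ⟨exists_seq_eq_bot_iff (f := fun x => c x x) (fun _ _ h => hc.mono h h)
    (fun x => hc.le_right x x) rfl fun _ => rfl, hnil, fun _ => ?_⟩
  simp only [hc.resid_eq_top_iff]
  constructor
  · rintro ⟨n, hn⟩ α β hαβ
    by_contra hnot
    have hsup : α ⊔ c ⊤ β = β :=
      (hαβ.eq_or_eq le_sup_left (sup_le hαβ.le (hc.le_right _ _))).resolve_left
        fun h => hnot (sup_eq_left.1 h)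
    have hβ := hc.le_sup_lowerCentralSeq hsup.ge n
    rw [hn, sup_bot_eq] at hβ
    exact hαβ.lt.not_ge hβ
  · rw [hnil]
    rintro h ⟨β, hβ, hfix⟩
    obtain ⟨α, -, hαβ⟩ := exists_le_covBy_of_lt (bot_lt_iff_ne_bot.2 hβ)
    exact hαβ.lt.not_ge (hfix ▸ h α β hαβ)
end

section
/- Let L be a complete lattice equipped with a commutator multiplication [·,·], with associated residuation (·:·). Then: (1) if η ∈ M(L) satisfies η = (η : η⁺), then η is a lonesome meet irreducible element; (2) if α ∈ J(L) satisfies [α,α] = α, then α is a lonesome join irreducible element. -/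
namespace IsCommutatorMult

variable {L : Type*} [CompleteLattice L] {c : L → L → L}

theorem le_left (hc : IsCommutatorMult c) (x y : L) : c x y ≤ x :=
  (hc.2.1 x y).trans inf_le_left

theorem mono_left (hc : IsCommutatorMult c) {x y : L} (h : x ≤ y) (z : L) : c x z ≤ c y z := by
  rw [← sup_eq_right.2 h, hc.sup_left]
  exact le_sup_left

theorem le_resid_iff (hc : IsCommutatorMult c) {x y z : L} : z ≤ resid c x y ↔ c z y ≤ x := by
  refine ⟨fun h => (hc.mono_left h y).trans ?_, fun h => le_sSup h⟩
  rw [resid, hc.2.2]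
  exact iSup₂_le fun _ h => h

theorem apply_sup_le_iff (hc : IsCommutatorMult c) (z β γ : L) :
    c z (β ⊔ γ) ≤ γ ↔ c z β ≤ β ⊓ γ := by
  rw [hc.1, hc.sup_left, sup_le_iff, hc.1 β, le_inf_iff]
  exact ⟨fun h => ⟨hc.le_right z β, h.1⟩, fun h => ⟨h.2, hc.le_left γ z⟩⟩

theorem apply_le_iff_of_projIntv (hc : IsCommutatorMult c) {p q : L × L} (h : ProjIntv p q) :
    ∀ z, c z p.2 ≤ p.1 ↔ c z q.2 ≤ q.1 := by
  induction h with
  | rel p q h => intro z; rw [h.1, h.2, hc.apply_sup_le_iff]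
  | refl p => exact fun _ => Iff.rfl
  | symm p q _ ih => exact fun z => (ih z).symm
  | trans p q r _ _ ih₁ ih₂ => exact fun z => (ih₁ z).trans (ih₂ z)

theorem apply_self_le_iff_of_projIntv (hc : IsCommutatorMult c) {p q : L × L}
    (h : ProjIntv p q) : c p.2 p.2 ≤ p.1 ↔ c q.2 q.2 ≤ q.1 := by
  induction h with
  | rel p q h =>
    rw [h.1, h.2, ← hc.apply_sup_le_iff, hc.sup_left p.2 q.1 (p.2 ⊔ q.1), sup_le_iff]
    exact (and_iff_left (hc.le_left _ _)).symm
  | refl p => exact Iff.rfl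
  | symm p q _ ih => exact ih.symm
  | trans p q r _ _ ih₁ ih₂ => exact ih₁.trans ih₂

theorem lonesomeMeet (hc : IsCommutatorMult c) {η : L} (hη : MeetIrred η)
    (h : η = resid c η (mplus η)) : LonesomeMeet η := by
  have le_iff (z : L) : z ≤ η ↔ c z (mplus η) ≤ η := by
    conv_lhs => rw [h]
    exact hc.le_resid_iff
  refine ⟨hη, fun φ _ hp => ?_⟩
  have lin (z : L) : c z (mplus φ) ≤ φ ↔ z ≤ η :=
    (hc.apply_le_iff_of_projIntv hp z).trans (le_iff z).symm
  by_contra hne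
  have hlt : φ < η := lt_of_le_of_ne ((lin φ).1 (hc.le_left _ _)) hne
  have hle : mplus φ ≤ η := sInf_le hlt
  have hself : c (mplus η) (mplus η) ≤ η :=
    (hc.apply_self_le_iff_of_projIntv hp).1 ((lin _).2 hle)
  exact hη.not_ge ((le_iff _).2 hself)

theorem lonesomeJoin (hc : IsCommutatorMult c) {α : L} (hα : JoinIrred α)
    (h : c α α = α) : LonesomeJoin α := by
  refine ⟨hα, fun σ _ hp => ?_⟩
  have lin : ∀ z, c z σ ≤ jminus σ ↔ c z α ≤ jminus α := hc.apply_le_iff_of_projIntv hp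
  have hself : ¬ c α α ≤ jminus α := by rw [h]; exact hα.not_ge
  have hσα : σ ≤ α := by
    by_contra hn
    have hlt : c α σ < σ :=
      lt_of_le_of_ne (hc.le_right _ _) fun e => hn (e ▸ hc.le_left α σ)
    exact hself ((lin α).1 (le_sSup hlt))
  by_contra hne
  have hle : σ ≤ jminus α := le_sSup (lt_of_le_of_ne hσα hne)
  have hσσ : c σ σ ≤ jminus σ := (lin σ).2 ((hc.le_left σ α).trans hle)
  exact hself ((hc.apply_self_le_iff_of_projIntv hp).1 hσσ)

end IsCommutatorMult

/-- special elements in commutator lattices are lonesome. -/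
theorem statement4 {L : Type*} [CompleteLattice L] (c : L → L → L)
    (hc : IsCommutatorMult c) :
    (∀ η : L, MeetIrred η → η = resid c η (mplus η) → LonesomeMeet η) ∧
    (∀ α : L, JoinIrred α → c α α = α → LonesomeJoin α) := by
  exact ⟨fun _ hη h => hc.lonesomeMeet hη h, fun _ hα h => hc.lonesomeJoin hα h⟩
end

section
/- Let L be a bialgebraic modular lattice, and let β ∈ J(L) and η ∈ M(L) be such that [β⁻, β] ⟷ [η, η⁺]. Then β is a lonesome join irreducible element of L if and only if η is a lonesome meet irreducible element of L. -/
section ModularCovers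

variable {L : Type*} [Lattice L]

theorem TransUp.covBy_iff [IsModularLattice L] {p q : L × L} (h : TransUp p q) :
    p.1 ⋖ p.2 ↔ q.1 ⋖ q.2 := by
  obtain ⟨a, b⟩ := p
  obtain ⟨c, d⟩ := q
  obtain ⟨h1, h2⟩ := h
  dsimp only at h1 h2 ⊢
  subst h1 h2
  exact ⟨fun h => covBy_sup_of_inf_covBy_left h, fun h => inf_covBy_of_covBy_sup_right h⟩

theorem ProjIntv.covBy_iff [IsModularLattice L] {p q : L × L} (h : ProjIntv p q) :
    p.1 ⋖ p.2 ↔ q.1 ⋖ q.2 := by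
  induction h with
  | rel _ _ h => exact h.covBy_iff
  | refl => rfl
  | symm _ _ _ ih => exact ih.symm
  | trans _ _ _ _ _ ih1 ih2 => exact ih1.trans ih2

theorem ProjIntv.symm {p q : L × L} (h : ProjIntv p q) : ProjIntv q p :=
  Relation.EqvGen.symm _ _ h

theorem ProjIntv.trans {p q r : L × L} (h : ProjIntv p q) (h' : ProjIntv q r) :
    ProjIntv p r :=
  Relation.EqvGen.trans _ _ _ h h'

theorem TransUp.projIntv {p q : L × L} (h : TransUp p q) : ProjIntv p q :=
  Relation.EqvGen.rel _ _ h

theorem ProjIntv.dual {p q : L × L} (h : ProjIntv p q) :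
    ProjIntv (L := Lᵒᵈ) (OrderDual.toDual p.2, OrderDual.toDual p.1)
      (OrderDual.toDual q.2, OrderDual.toDual q.1) := by
  induction h with
  | rel x y h =>
    refine (TransUp.projIntv ⟨?_, ?_⟩).symm
    · exact h.2.trans (inf_comm _ _)
    · exact h.1.trans (sup_comm _ _)
  | refl => exact Relation.EqvGen.refl _
  | symm _ _ _ ih => exact ih.symm
  | trans _ _ _ _ _ ih1 ih2 => exact ih1.trans ih2

end ModularCovers

section Irreducibles

variable {L : Type*} [CompleteLattice L]

theorem mplus_le_of_lt {η x : L} (h : η < x) : mplus η ≤ x := sInf_le h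

theorem le_jminus_of_lt {ρ x : L} (h : x < ρ) : x ≤ jminus ρ := le_sSup h

theorem MeetIrred.covBy {η : L} (h : MeetIrred η) : η ⋖ mplus η :=
  ⟨h, fun _ hc hc' => (mplus_le_of_lt hc).not_gt hc'⟩

/-- In an algebraic lattice every covering pair transposes up to the covering pair of some
meet irreducible element. -/
theorem exists_meetIrred_transUp [IsCompactlyGenerated L] {a b : L} (hab : a ⋖ b) :
    ∃ φ : L, MeetIrred φ ∧ TransUp (a, b) (φ, mplus φ) := by
  obtain ⟨c, hc, hcb, hca⟩ : ∃ c : L, IsCompactElement c ∧ c ≤ b ∧ ¬ c ≤ a := by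
    by_contra! H
    exact hab.lt.not_ge (le_iff_compact_le_imp.2 fun c hc hcb => H c hc hcb)
  obtain ⟨φ, haφ, hφ⟩ := zorn_le_nonempty₀ {x : L | ¬ c ≤ x} (fun C hC hchain y hy => by
    refine ⟨sSup C, fun hle => ?_, fun z hz => le_sSup hz⟩
    obtain ⟨x, hx, hcx⟩ :=
      (CompleteLattice.isCompactElement_iff_le_of_directed_sSup_le L c).1 hc C ⟨y, hy⟩
        hchain.directedOn hle
    exact hC hx hcx) a hca
  have hcφ : ¬ c ≤ φ := hφ.prop
  have hup : ∀ x, φ < x → c ≤ x := fun x hx => by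
    by_contra h
    exact hx.not_ge (hφ.le_of_ge h hx.le)
  have hlt : φ < φ ⊔ c := left_lt_sup.2 hcφ
  have hplus : mplus φ = φ ⊔ c :=
    le_antisymm (mplus_le_of_lt hlt) (le_sInf fun x hx => sup_le (le_of_lt hx) (hup x hx))
  have hac : a ⊔ c = b :=
    (hab.eq_or_eq le_sup_left (sup_le hab.le hcb)).resolve_left fun h => hca (h ▸ le_sup_right)
  refine ⟨φ, by rw [MeetIrred, hplus]; exact hlt, ?_, ?_⟩
  · change mplus φ = b ⊔ φ
    rw [hplus, ← hac, sup_right_comm, sup_eq_right.2 haφ]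
  · refine ((hab.eq_or_eq (le_inf hab.le haφ) inf_le_left).resolve_right fun h => ?_).symm
    exact hcφ (hcb.trans (inf_eq_left.1 h))

theorem LonesomeMeet.transUp [IsModularLattice L] [IsCompactlyGenerated L] {η : L}
    (hη : LonesomeMeet η) {p : L × L} (hp : ProjIntv p (η, mplus η)) :
    TransUp p (η, mplus η) := by
  obtain ⟨φ, hφ, ht⟩ := exists_meetIrred_transUp (hp.covBy_iff.2 hη.1.covBy)
  obtain rfl := hη.2 φ hφ (ht.projIntv.symm.trans hp)
  exact ht

/-- Two covers of `m` that are projective to the cover of a lonesome `η` coincide: otherwise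
`η` would contain the top of a third cover of `m`, perspective to both. -/
theorem LonesomeMeet.eq_of_transUp [IsModularLattice L] [IsCompactlyGenerated L] {η m s b : L}
    (hη : LonesomeMeet η) (hs : TransUp (m, s) (η, mplus η))
    (hb : TransUp (m, b) (η, mplus η)) : s = b := by
  by_contra hne
  have cs : m ⋖ s := hs.covBy_iff.2 hη.1.covBy
  have cb : m ⋖ b := hb.covBy_iff.2 hη.1.covBy
  obtain ⟨hs1, hs2⟩ := hs
  have hb1 := hb.1
  dsimp only at hs1 hs2 hb1
  have hbs : m = b ⊓ s := by
    refine ((cb.eq_or_eq (le_inf cb.le cs.le) inf_le_left).resolve_right fun h => ?_).symm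
    exact (cs.eq_or_eq cb.le (inf_eq_left.1 h)).elim cb.ne' fun h => hne h.symm
  have he : TransUp (m, η ⊓ (s ⊔ b)) (s, s ⊔ b) := by
    refine ⟨?_, ?_⟩
    · change s ⊔ b = η ⊓ (s ⊔ b) ⊔ s
      have hle : s ⊔ b ≤ s ⊔ η :=
        sup_le le_sup_left (le_sup_left.trans_eq (hb1.symm.trans hs1))
      rw [sup_comm _ s, ← sup_inf_assoc_of_le η le_sup_left, inf_eq_right.2 hle]
    · change m = η ⊓ (s ⊔ b) ⊓ s
      rw [inf_assoc, inf_eq_right.2 (le_sup_left : s ≤ s ⊔ b), inf_comm]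
      exact hs2
  have hbt : TransUp (m, b) (s, s ⊔ b) := ⟨sup_comm _ _, hbs⟩
  have h := hη.transUp (he.projIntv.trans (hbt.projIntv.symm.trans hb.projIntv))
  have h1 : mplus η = η ⊓ (s ⊔ b) ⊔ η := h.1
  rw [sup_eq_right.2 inf_le_left] at h1
  exact hη.1.ne' h1

theorem LonesomeMeet.lonesomeJoin [IsModularLattice L] [IsCompactlyGenerated L] {β η : L}
    (hη : LonesomeMeet η) (hβ : JoinIrred β)
    (hproj : ProjIntv (jminus β, β) (η, mplus η)) : LonesomeJoin β := by
  refine ⟨hβ, fun σ hσ hσβ => ?_⟩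
  obtain ⟨hb1, hb2⟩ := hη.transUp hproj
  obtain ⟨hs1, hs2⟩ := hη.transUp (hσβ.trans hproj)
  dsimp only at hb1 hb2 hs1 hs2
  have hbη : jminus β ≤ η := hb2 ▸ inf_le_right
  have hsη : jminus σ ≤ η := hs2 ▸ inf_le_right
  have hmη : jminus σ ⊔ jminus β ≤ η := sup_le hsη hbη
  have key : ∀ ρ : L, mplus η = ρ ⊔ η → jminus ρ = ρ ⊓ η →
      jminus ρ ≤ jminus σ ⊔ jminus β →
      TransUp (jminus σ ⊔ jminus β, (jminus σ ⊔ jminus β) ⊔ ρ) (η, mplus η) := by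
    intro ρ h1 h2 h3
    refine ⟨?_, ?_⟩
    · change mplus η = (jminus σ ⊔ jminus β) ⊔ ρ ⊔ η
      rw [h1, sup_right_comm, sup_eq_right.2 hmη, sup_comm]
    · change jminus σ ⊔ jminus β = ((jminus σ ⊔ jminus β) ⊔ ρ) ⊓ η
      rw [sup_inf_assoc_of_le ρ hmη, ← h2, sup_eq_left.2 h3]
  have heq := hη.eq_of_transUp (key σ hs1 hs2 le_sup_left) (key β hb1 hb2 le_sup_right)
  have hβle : β ≤ jminus β ⊔ σ := by
    have h : β ≤ (jminus σ ⊔ jminus β) ⊔ σ := heq ▸ le_sup_right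
    exact h.trans (sup_le (sup_le ((le_of_lt hσ).trans le_sup_right) le_sup_left) le_sup_right)
  have hβσ : β ≤ σ := by
    by_contra hn
    have hle : σ ⊓ β ≤ jminus β := le_jminus_of_lt (inf_lt_right.2 hn)
    have hmod : (jminus β ⊔ σ) ⊓ β = jminus β ⊔ σ ⊓ β := sup_inf_assoc_of_le σ (le_of_lt hβ)
    rw [inf_eq_right.2 hβle, sup_eq_left.2 hle] at hmod
    exact hβ.ne' hmod
  by_contra hne
  have hβη : β ≤ η := (le_jminus_of_lt (lt_of_le_of_ne hβσ (Ne.symm hne))).trans hsη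
  rw [sup_eq_right.2 hβη] at hb1
  exact hη.1.ne' hb1

end Irreducibles

/-- lonesomeness transfers between projective join and meet irreducibles. -/
theorem statement9 {L : Type*} [CompleteLattice L] [IsModularLattice L]
    [IsCompactlyGenerated L] [IsCompactlyGenerated Lᵒᵈ]
    (β η : L) (hβ : JoinIrred β) (hη : MeetIrred η)
    (hproj : ProjIntv (jminus β, β) (η, mplus η)) :
    LonesomeJoin β ↔ LonesomeMeet η := by
  refine ⟨fun h => ?_, fun h => h.lonesomeJoin hβ hproj⟩
  have hd : LonesomeMeet (OrderDual.toDual β) :=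
    ⟨hβ, fun φ hφ hp => h.2 (OrderDual.ofDual φ) hφ hp.dual⟩
  have hj : LonesomeJoin (OrderDual.toDual η) := hd.lonesomeJoin hη hproj.symm.dual
  exact ⟨hη, fun φ hφ hp => hj.2 (OrderDual.toDual φ) hφ hp.dual⟩
end

section
/- Let L be a bialgebraic modular lattice, let ⌊·,·⌋_L be the largest commutator operation on L, and let ⌊x : y⌋ := ⋁{ z ∈ L : ⌊z,y⌋_L ≤ x } be its associated residuation. Then for all α, β ∈ L with α ≺ β, ⌊α : β⌋ = Γ(α,β). -/
section ProjectivityInModularLattices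

variable {L : Type*}

/-- In a modular lattice, an interval that transposes up from a covering is a covering. -/
theorem TransUp.covBy_of_covBy [Lattice L] [IsModularLattice L] {a b c d : L}
    (h : TransUp (a, b) (c, d)) (hab : a ⋖ b) : c ⋖ d := by
  obtain ⟨h₁, h₂⟩ := h
  simp only at h₁ h₂
  subst h₁ h₂
  exact covBy_sup_of_inf_covBy_left hab

/-- In a modular lattice, an interval that transposes down from a covering is a covering. -/
theorem TransUp.covBy_of_covBy' [Lattice L] [IsModularLattice L] {a b c d : L}
    (h : TransUp (a, b) (c, d)) (hcd : c ⋖ d) : a ⋖ b := by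
  obtain ⟨h₁, h₂⟩ := h
  simp only at h₁ h₂
  subst h₁ h₂
  exact inf_covBy_of_covBy_sup_right hcd

/-- In an algebraic lattice every covering transposes up to one whose lower end is
completely meet irreducible. -/
theorem exists_transUp_forall_lt [CompleteLattice L] [IsCompactlyGenerated L] {a b : L}
    (h : a ⋖ b) : ∃ c d : L, TransUp (a, b) (c, d) ∧ ∀ w, c < w → d ≤ w := by
  obtain ⟨k, hk, hkb, hka⟩ : ∃ k, IsCompactElement k ∧ k ≤ b ∧ ¬ k ≤ a := by
    by_contra! hcon
    exact h.lt.not_ge (le_iff_compact_le_imp.2 fun k hk hkb => hcon k hk hkb)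
  obtain ⟨c, hac, hc⟩ := zorn_le_nonempty₀ {w : L | a ≤ w ∧ ¬ k ≤ w} (by
    intro C hC hchain y hy
    refine ⟨sSup C, ⟨(hC hy).1.trans (le_sSup hy), fun hle => ?_⟩, fun z hz => le_sSup hz⟩
    obtain ⟨x, hx, hkx⟩ := (CompleteLattice.isCompactElement_iff_le_of_directed_sSup_le L k).1 hk
      C ⟨y, hy⟩ hchain.directedOn hle
    exact (hC hx).2 hkx) a ⟨le_rfl, hka⟩
  refine ⟨c, b ⊔ c, ⟨rfl, ?_⟩, fun w hw => ?_⟩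
  · refine ((h.eq_or_eq (le_inf h.le hac) inf_le_left).resolve_right fun heq => ?_).symm
    exact hc.prop.2 (hkb.trans (inf_eq_left.1 heq))
  · have hkw : k ≤ w := by
      by_contra hkw
      exact hw.not_ge (hc.le_of_ge ⟨hac.trans hw.le, hkw⟩ hw.le)
    have hb : a ⊔ k = b := (h.eq_or_eq le_sup_left (sup_le h.le hkb)).resolve_left
      fun heq => hka (sup_eq_left.1 heq)
    exact sup_le (hb ▸ sup_le (hac.trans hw.le) hkw) hw.le

/-- In a dually algebraic lattice every covering transposes down to one whose upper end is
completely join irreducible. -/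
theorem exists_transUp_forall_gt [CompleteLattice L] [IsCompactlyGenerated Lᵒᵈ] {a b : L}
    (h : a ⋖ b) : ∃ c d : L, TransUp (c, d) (a, b) ∧ ∀ w, w < d → w ≤ c := by
  obtain ⟨d, c, ⟨h₁, h₂⟩, hd⟩ := exists_transUp_forall_lt h.toDual
  refine ⟨OrderDual.ofDual c, OrderDual.ofDual d, ⟨?_, ?_⟩, fun w hw => hd (OrderDual.toDual w) hw⟩
  · exact (congrArg OrderDual.ofDual h₂).trans (sup_comm _ _)
  · exact (congrArg OrderDual.ofDual h₁).trans (inf_comm _ _)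

variable [CompleteLattice L]

theorem mplus_eq_of_forall_lt {c d : L} (hcd : c < d) (h : ∀ w, c < w → d ≤ w) :
    mplus c = d :=
  le_antisymm (sInf_le hcd) (le_sInf h)

/-- The coverings that are projective to `[α, β]`. -/
def CovProj (α β : L) (a b : L) : Prop :=
  a ⋖ b ∧ ProjIntv (a, b) (α, β)

theorem CovProj.up [IsModularLattice L] {α β a b c d : L} (hp : CovProj α β a b)
    (h : TransUp (a, b) (c, d)) : CovProj α β c d :=
  ⟨h.covBy_of_covBy hp.1, ((Relation.EqvGen.rel _ _ h).symm).trans _ _ _ hp.2⟩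

theorem CovProj.down [IsModularLattice L] {α β a b c d : L} (hp : CovProj α β c d)
    (h : TransUp (a, b) (c, d)) : CovProj α β a b :=
  ⟨h.covBy_of_covBy' hp.1, (Relation.EqvGen.rel _ _ h).trans _ _ _ hp.2⟩

/-- The lower end of a covering projective to `[α, β]` lies below `Γ(α, β)`. -/
theorem CovProj.le_gammaEl [IsModularLattice L] [IsCompactlyGenerated L] {α β a b : L}
    (hp : CovProj α β a b) : a ≤ GammaEl α β := by
  obtain ⟨c, d, ht, hc⟩ := exists_transUp_forall_lt hp.1
  have hq := hp.up ht
  have hd := mplus_eq_of_forall_lt hq.1.lt hc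
  have hac : a ≤ c := ht.2.le.trans inf_le_right
  refine hac.trans (le_sSup ⟨?_, ?_⟩)
  · rw [MeetIrred, hd]
    exact hq.1.lt
  · rw [hd]
    exact hq.2

/-- A completely join irreducible `ρ` with lower cover `κ` such that `[κ, ρ]` is projective to
`[α, β]`. -/
def JoinIrredProj (α β κ ρ : L) : Prop :=
  CovProj α β κ ρ ∧ ∀ w, w < ρ → w ≤ κ

theorem JoinIrredProj.covProj_sup [IsModularLattice L] {α β κ ρ w : L}
    (h : JoinIrredProj α β κ ρ) (hw : ¬ ρ ≤ w) : CovProj α β (κ ⊔ w) (ρ ⊔ w) := by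
  refine h.1.up ⟨?_, ?_⟩
  · show ρ ⊔ w = ρ ⊔ (κ ⊔ w)
    rw [← sup_assoc, sup_eq_left.2 h.1.1.le]
  · have hle : ρ ⊓ w ≤ κ := h.2 _ (inf_lt_left.2 hw)
    show κ = ρ ⊓ (κ ⊔ w)
    rw [inf_comm, sup_inf_assoc_of_le w h.1.1.le, inf_comm, sup_eq_left.2 hle]

theorem JoinIrredProj.le_of_not_le_gammaEl [IsModularLattice L] [IsCompactlyGenerated L]
    {α β κ ρ y : L} (h : JoinIrredProj α β κ ρ) (hy : ¬ y ≤ GammaEl α β) : ρ ≤ y := by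
  by_contra hle
  exact hy (le_sup_right.trans (h.covProj_sup hle).le_gammaEl)

/-- Every covering projective to `[α, β]` is separated by a completely join irreducible element
whose own covering is projective to `[α, β]`. -/
theorem CovProj.exists_joinIrredProj [IsModularLattice L] [IsCompactlyGenerated Lᵒᵈ]
    {α β a b : L} (hp : CovProj α β a b) : ∃ κ ρ, JoinIrredProj α β κ ρ ∧ ρ ≤ b ∧ ¬ ρ ≤ a := by
  obtain ⟨κ, ρ, ht, hρ⟩ := exists_transUp_forall_gt hp.1
  have hb : b = ρ ⊔ a := ht.1
  refine ⟨κ, ρ, ⟨hp.down ht, hρ⟩, hb ▸ le_sup_left, fun hle => ?_⟩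
  exact hp.1.lt.ne' (hb.trans (sup_eq_right.2 hle))

/-- The join of the completely join irreducible elements below `x` whose covering is projective
to `[α, β]`. -/
def lowerPart (α β x : L) : L :=
  sSup {ρ : L | ρ ≤ x ∧ ∃ κ, JoinIrredProj α β κ ρ}

theorem lowerPart_le (α β x : L) : lowerPart α β x ≤ x :=
  sSup_le fun _ h => h.1

theorem lowerPart_mono (α β : L) : Monotone (lowerPart α β) :=
  fun _ _ h => sSup_le_sSup fun _ hρ => ⟨hρ.1.trans h, hρ.2⟩

theorem lowerPart_le_of_not_le_gammaEl [IsModularLattice L] [IsCompactlyGenerated L]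
    {α β y : L} (x : L) (hy : ¬ y ≤ GammaEl α β) : lowerPart α β x ≤ y :=
  sSup_le fun _ ⟨_, _, h⟩ => h.le_of_not_le_gammaEl hy

theorem CovProj.not_lowerPart_le [IsModularLattice L] [IsCompactlyGenerated Lᵒᵈ]
    {α β a b : L} (hp : CovProj α β a b) : ¬ lowerPart α β b ≤ a := by
  obtain ⟨κ, ρ, h, hb, ha⟩ := hp.exists_joinIrredProj
  exact fun hle => ha ((le_sSup ⟨hb, κ, h⟩ : ρ ≤ lowerPart α β b).trans hle)

/-- In a bialgebraic modular lattice, `lowerPart` preserves arbitrary joins. -/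
theorem lowerPart_sSup [IsModularLattice L] [IsCompactlyGenerated L] [IsCompactlyGenerated Lᵒᵈ]
    (α β : L) (S : Set L) : lowerPart α β (sSup S) = ⨆ x ∈ S, lowerPart α β x := by
  refine le_antisymm (sSup_le ?_) (iSup₂_le fun x hx => lowerPart_mono α β (le_sSup hx))
  rintro ρ ⟨hρS, κ, hρ⟩
  by_contra hle
  obtain ⟨c, d, ht, hc⟩ := exists_transUp_forall_lt (hρ.covProj_sup hle).1
  have hq := (hρ.covProj_sup hle).up ht
  have hwc : ⨆ x ∈ S, lowerPart α β x ≤ c := le_sup_right.trans (ht.2.le.trans inf_le_right)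
  obtain ⟨x, hx, hxc⟩ : ∃ x ∈ S, ¬ x ≤ c := by
    by_contra! hcon
    have hd : d ≤ c := ht.1.le.trans (sup_le (sup_le (hρS.trans (sSup_le hcon)) hwc) le_rfl)
    exact hq.1.lt.not_ge hd
  have hdx : d ≤ c ⊔ x := hc _ (left_lt_sup.2 hxc)
  have hr : CovProj α β (x ⊓ c) (x ⊓ d) := by
    refine hq.down ⟨?_, ?_⟩
    · show d = x ⊓ d ⊔ c
      rw [sup_comm, ← sup_inf_assoc_of_le x hq.1.le, inf_eq_right.2 hdx]
    · show x ⊓ c = x ⊓ d ⊓ c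
      rw [inf_assoc, inf_eq_right.2 hq.1.le]
  exact hr.not_lowerPart_le (le_inf ((lowerPart_le _ _ _).trans inf_le_left)
    ((lowerPart_mono α β inf_le_left).trans ((le_iSup₂_of_le x hx le_rfl).trans hwc)))

/-- A commutator multiplication that vanishes on pairs below `Γ(α, β)` and equals
`lowerPart α β y` at `(x, y)` when only `y` is below `Γ(α, β)`. -/
def gammaComm (α β x y : L) : L :=
  (⨆ _ : ¬ x ≤ GammaEl α β, lowerPart α β y) ⊔ (⨆ _ : ¬ y ≤ GammaEl α β, lowerPart α β x)

theorem isCommutatorMult_gammaComm [IsModularLattice L] [IsCompactlyGenerated L]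
    [IsCompactlyGenerated Lᵒᵈ] (α β : L) : IsCommutatorMult (gammaComm α β) := by
  refine ⟨fun x y => sup_comm _ _, fun x y => ?_, fun S y => ?_⟩
  · exact sup_le
      (iSup_le fun hx => le_inf (lowerPart_le_of_not_le_gammaEl y hx) (lowerPart_le _ _ _))
      (iSup_le fun hy => le_inf (lowerPart_le _ _ _) (lowerPart_le_of_not_le_gammaEl x hy))
  · simp only [gammaComm, iSup_sup_eq]
    congr 1
    · refine le_antisymm (iSup_le fun hS => ?_)
        (iSup₂_le fun x hx => iSup_le fun hxΓ =>
          le_iSup_of_le (fun hle => hxΓ ((le_sSup hx).trans hle)) le_rfl)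
      obtain ⟨x, hx, hxΓ⟩ : ∃ x ∈ S, ¬ x ≤ GammaEl α β := by
        by_contra! hcon
        exact hS (sSup_le hcon)
      exact le_iSup₂_of_le x hx (le_iSup_of_le hxΓ le_rfl)
    · by_cases hy : y ≤ GammaEl α β <;> simp [hy, lowerPart_sSup]

theorem le_lcomm {c : L → L → L} (hc : IsCommutatorMult c) (x y : L) : c x y ≤ lcomm x y :=
  le_sSup ⟨c, hc, rfl⟩

theorem lcomm_le_iff {x y z : L} :
    lcomm x y ≤ z ↔ ∀ c : L → L → L, IsCommutatorMult c → c x y ≤ z :=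
  ⟨fun h _ hc => (le_lcomm hc x y).trans h, fun h => sSup_le fun _ ⟨c, hc, hz⟩ => hz ▸ h c hc⟩

theorem IsCommutatorMult.map_sup_right {c : L → L → L} (hc : IsCommutatorMult c) (x y z : L) :
    c x (y ⊔ z) = c x y ⊔ c x z := by
  rw [hc.1 x, ← sSup_pair, hc.2.2, iSup_pair, hc.1 y, hc.1 z]

theorem IsCommutatorMult.le_iff_of_transUp {c : L → L → L} (hc : IsCommutatorMult c)
    {p q : L × L} (h : TransUp p q) (z : L) : c z p.2 ≤ p.1 ↔ c z q.2 ≤ q.1 := by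
  obtain ⟨h₁, h₂⟩ := h
  rw [h₁, hc.map_sup_right]
  constructor
  · intro hle
    exact sup_le (hle.trans (h₂.le.trans inf_le_right)) ((hc.2.1 _ _).trans inf_le_right)
  · intro hle
    rw [h₂]
    exact le_inf ((hc.2.1 _ _).trans inf_le_right) (le_sup_left.trans hle)

/-- Residuation is invariant under projectivity. -/
theorem IsCommutatorMult.le_iff_of_projIntv {c : L → L → L} (hc : IsCommutatorMult c)
    {p q : L × L} (h : ProjIntv p q) (z : L) : c z p.2 ≤ p.1 ↔ c z q.2 ≤ q.1 := by
  induction h with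
  | rel _ _ h => exact hc.le_iff_of_transUp h z
  | refl _ => exact Iff.rfl
  | symm _ _ _ ih => exact ih.symm
  | trans _ _ _ _ _ ih₁ ih₂ => exact ih₁.trans ih₂

end ProjectivityInModularLattices

/-- in a bialgebraic modular lattice, the residuation of the largest
commutator operation at a prime interval is `Γ(α,β)`. -/
theorem statement16 {L : Type*} [CompleteLattice L] [IsModularLattice L]
    [IsCompactlyGenerated L] [IsCompactlyGenerated Lᵒᵈ]
    (α β : L) (h : α ⋖ β) :
    sSup {z : L | lcomm z β ≤ α} = GammaEl α β := by
  refine le_antisymm (sSup_le fun z hz => ?_) (sSup_le_sSup ?_)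
  · by_contra hzΓ
    have hp : CovProj α β α β := ⟨h, Relation.EqvGen.refl _⟩
    have hle : lowerPart α β β ≤ gammaComm α β z β :=
      le_sup_of_le_left (le_iSup_of_le hzΓ le_rfl)
    exact hp.not_lowerPart_le
      (hle.trans ((le_lcomm (isCommutatorMult_gammaComm α β) z β).trans hz))
  · rintro η ⟨-, hproj⟩
    exact lcomm_le_iff.2 fun c hc =>
      (hc.le_iff_of_projIntv hproj η).1 ((hc.2.1 _ _).trans inf_le_left)
end
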